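/- arXiv:1106.4499 — 5 statements merged into one kernel-verified Lean document; each statement's English description precedes it below -/
import Mathlib

section
/- Fix integers $z_a, z_b \ge 2$ and $p \in (0,1]$. Let $p_a(z_a,1)=p$, $p_a(z_a,0)=1-p$, set $\pi_{aa} = \frac{z_a+1-p}{z_a(z_a+1)}$ and $\pi_{ab} = \frac{1}{1+z_b}$, and define $u_a(t_a,t_b) = \sum_{k_a \ge t_a}\sum_{k_b \ge t_b} p_a(k_a,k_b) \binom{k_a}{t_a}\pi_{aa}^{t_a}(1-\pi_{aa})^{k_a-t_a} \binom{k_b}{t_b}\pi_{ab}^{t_b}(1-\pi_{ab})^{k_b-t_b}$. Then for all $\tau_a, \tau_b \in \mathbb{C}$, the generating function $\mathcal{U}_a(\tau_a,\tau_b) := \sum_{t_a,t_b \ge 0} u_a(t_a,t_b)\, \tau_a^{t_a}\tau_b^{t_b}$ equals $\dfrac{\big(p - p\tau_a + (z_a+1)(\tau_a + z_a - 1)\big)^{z_a}\, \big(1 + p(\tau_b - 1) + z_b\big)}{(z_a+1)^{z_a}\, z_a^{z_a}\, (z_b+1)}$. -/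
theorem toppling_branch_generating_function
    (za zb : ℕ) (hza : 2 ≤ za) (hzb : 2 ≤ zb)
    (p : ℝ) (hp : p ∈ Set.Ioc (0 : ℝ) 1)
    (pa : ℕ × ℕ → ℝ)
    (hpa : ∀ k : ℕ × ℕ, pa k = if k = (za, 1) then p else if k = (za, 0) then 1 - p else 0)
    (πaa πab : ℝ)
    (hπaa : πaa = ((za : ℝ) + 1 - p) / ((za : ℝ) * ((za : ℝ) + 1)))
    (hπab : πab = 1 / (1 + (zb : ℝ)))
    (u : ℕ × ℕ → ℝ)
    (hu : ∀ ta tb : ℕ, u (ta, tb) =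
      ∑' k : ℕ × ℕ,
        if ta ≤ k.1 ∧ tb ≤ k.2 then
          pa k * (k.1.choose ta : ℝ) * πaa ^ ta * (1 - πaa) ^ (k.1 - ta) *
            (k.2.choose tb : ℝ) * πab ^ tb * (1 - πab) ^ (k.2 - tb)
        else 0) :
    ∀ τa τb : ℂ,
      (∑' t : ℕ × ℕ, (u t : ℂ) * τa ^ t.1 * τb ^ t.2) =
        ((p : ℂ) - (p : ℂ) * τa + ((za : ℂ) + 1) * (τa + (za : ℂ) - 1)) ^ za *
          (1 + (p : ℂ) * (τb - 1) + (zb : ℂ)) /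
          (((za : ℂ) + 1) ^ za * (za : ℂ) ^ za * ((zb : ℂ) + 1)) := by
  intro τa τb
  have hu' : ∀ ta tb : ℕ, u (ta, tb) =
      ((za.choose ta : ℝ) * πaa ^ ta * (1 - πaa) ^ (za - ta)) *
        (p * (((1 : ℕ).choose tb : ℝ) * πab ^ tb * (1 - πab) ^ (1 - tb)) +
          (1 - p) * (((0 : ℕ).choose tb : ℝ) * πab ^ tb * (1 - πab) ^ (0 - tb))) := by
    intro ta tb
    rw [hu, tsum_eq_sum (s := {(za, 1), (za, 0)})]
    · rw [Finset.sum_pair (by simp)]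
      have key : ∀ j : ℕ, (if ta ≤ za ∧ tb ≤ j then
          pa (za, j) * (za.choose ta : ℝ) * πaa ^ ta * (1 - πaa) ^ (za - ta) *
            (j.choose tb : ℝ) * πab ^ tb * (1 - πab) ^ (j - tb) else 0) =
          pa (za, j) * (za.choose ta : ℝ) * πaa ^ ta * (1 - πaa) ^ (za - ta) *
            (j.choose tb : ℝ) * πab ^ tb * (1 - πab) ^ (j - tb) := by
        intro j
        split_ifs with h
        · rfl
        · rw [not_and_or, not_le, not_le] at h
          rcases h with h | h <;> simp [Nat.choose_eq_zero_of_lt h]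
      have h1 : pa (za, 1) = p := by simp [hpa]
      have h0 : pa (za, 0) = 1 - p := by simp [hpa]
      dsimp only
      rw [key 1, key 0, h1, h0]
      ring
    · intro k hk
      simp only [Finset.mem_insert, Finset.mem_singleton, not_or] at hk
      have : pa k = 0 := by rw [hpa, if_neg hk.1, if_neg hk.2]
      simp [this]
  rw [tsum_eq_sum (s := Finset.range (za + 1) ×ˢ Finset.range 2)]
  · rw [Finset.sum_product]
    have hz : (za : ℂ) ≠ 0 := by exact_mod_cast (by omega : za ≠ 0)
    have hz1 : (za : ℂ) + 1 ≠ 0 := by exact_mod_cast (by omega : za + 1 ≠ 0)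
    have hb1 : (zb : ℂ) + 1 ≠ 0 := by exact_mod_cast (by omega : zb + 1 ≠ 0)
    have hb1' : 1 + (zb : ℂ) ≠ 0 := by rwa [add_comm]
    have hA : (πaa : ℂ) * τa + (1 - πaa) =
        ((p : ℂ) - (p : ℂ) * τa + ((za : ℂ) + 1) * (τa + (za : ℂ) - 1)) /
          (((za : ℂ) + 1) * za) := by
      rw [hπaa]; push_cast; field_simp; ring
    have hB : (1 : ℂ) + p * πab * (τb - 1) =
        (1 + (p : ℂ) * (τb - 1) + (zb : ℂ)) / ((zb : ℂ) + 1) := by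
      rw [hπab]; push_cast; field_simp; ring
    have hR : ((p : ℂ) - (p : ℂ) * τa + ((za : ℂ) + 1) * (τa + (za : ℂ) - 1)) ^ za *
          (1 + (p : ℂ) * (τb - 1) + (zb : ℂ)) /
          (((za : ℂ) + 1) ^ za * (za : ℂ) ^ za * ((zb : ℂ) + 1)) =
        ((πaa : ℂ) * τa + (1 - πaa)) ^ za * (1 + p * πab * (τb - 1)) := by
      rw [hA, hB, div_pow, mul_pow, div_mul_div_comm]
    rw [hR, add_pow, Finset.sum_mul]
    refine Finset.sum_congr rfl fun ta _ => ?_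
    simp only [Finset.sum_range_succ, Finset.sum_range_zero, hu']
    push_cast
    simp only [mul_pow]
    norm_num
    ring
  · rintro ⟨ta, tb⟩ ht
    simp only [Finset.mem_product, Finset.mem_range, not_and_or, not_lt] at ht
    rw [hu']
    rcases ht with h | h
    · rw [Nat.choose_eq_zero_of_lt (by omega : za < ta)]; simp
    · rw [Nat.choose_eq_zero_of_lt (by omega : 1 < tb),
        Nat.choose_eq_zero_of_lt (by omega : 0 < tb)]; simp
end

section
/- Fix integers $z_a, z_b \ge 2$ and $p \in (0,1]$. Let $p_a(z_a,1)=p$, $p_a(z_a,0)=1-p$, set $\pi_{aa} = \frac{z_a+1-p}{z_a(z_a+1)}$ and $\pi_{ab} = \frac{1}{1+z_b}$, and define $u_a(t_a,t_b) = \sum_{k_a \ge t_a}\sum_{k_b \ge t_b} p_a(k_a,k_b) \binom{k_a}{t_a}\pi_{aa}^{t_a}(1-\pi_{aa})^{k_a-t_a} \binom{k_b}{t_b}\pi_{ab}^{t_b}(1-\pi_{ab})^{k_b-t_b}$. Then the first moments satisfy $\langle u_a\rangle_a := \sum_{t_a,t_b} t_a\, u_a(t_a,t_b) = 1 - \frac{p}{1+z_a}$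 and $\langle u_a\rangle_b := \sum_{t_a,t_b} t_b\, u_a(t_a,t_b) = \frac{p}{1+z_b}$. -/
theorem binom_total (n : ℕ) (x : ℝ) :
    ∑ t ∈ Finset.range (n + 1), (n.choose t : ℝ) * x ^ t * (1 - x) ^ (n - t) = 1 := by
  have h := congrArg (Polynomial.eval x) (bernsteinPolynomial.sum ℝ n)
  simpa [Polynomial.eval_finset_sum, bernsteinPolynomial] using h

theorem binom_mean (n : ℕ) (x : ℝ) :
    ∑ t ∈ Finset.range (n + 1), (t : ℝ) * ((n.choose t : ℝ) * x ^ t * (1 - x) ^ (n - t))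
      = n * x := by
  have h := congrArg (Polynomial.eval x) (bernsteinPolynomial.sum_smul ℝ n)
  simpa [Polynomial.eval_finset_sum, bernsteinPolynomial] using h

theorem toppling_branch_first_moments
    (za zb : ℕ) (hza : 2 ≤ za) (hzb : 2 ≤ zb)
    (p : ℝ) (hp : p ∈ Set.Ioc (0 : ℝ) 1)
    (pa : ℕ × ℕ → ℝ)
    (hpa : ∀ k : ℕ × ℕ, pa k = if k = (za, 1) then p else if k = (za, 0) then 1 - p else 0)
    (πaa πab : ℝ)
    (hπaa : πaa = ((za : ℝ) + 1 - p) / ((za : ℝ) * ((za : ℝ) + 1)))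
    (hπab : πab = 1 / (1 + (zb : ℝ)))
    (u : ℕ × ℕ → ℝ)
    (hu : ∀ ta tb : ℕ, u (ta, tb) =
      ∑' k : ℕ × ℕ,
        if ta ≤ k.1 ∧ tb ≤ k.2 then
          pa k * (k.1.choose ta : ℝ) * πaa ^ ta * (1 - πaa) ^ (k.1 - ta) *
            (k.2.choose tb : ℝ) * πab ^ tb * (1 - πab) ^ (k.2 - tb)
        else 0) :
    (∑' t : ℕ × ℕ, (t.1 : ℝ) * u t) = 1 - p / (1 + (za : ℝ))
    ∧ (∑' t : ℕ × ℕ, (t.2 : ℝ) * u t) = p / (1 + (zb : ℝ)) := by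
  have hu' : ∀ ta tb : ℕ, u (ta, tb) =
      ((za.choose ta : ℝ) * πaa ^ ta * (1 - πaa) ^ (za - ta)) *
        (if tb = 0 then p * (1 - πab) + (1 - p) else if tb = 1 then p * πab else 0) := by
    intro ta tb
    rw [hu, tsum_eq_sum (s := {(za, 1), (za, 0)})]
    · rw [Finset.sum_pair (by simp)]
      simp only [hpa]
      by_cases h : ta ≤ za
      · rcases tb with _ | _ | tb
        · simp [h]; ring
        · simp [h]; ring
        · simp
      · simp [h, Nat.choose_eq_zero_of_lt (not_le.mp h)]
    · intro k hk
      simp only [Finset.mem_insert, Finset.mem_singleton, not_or] at hk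
      simp [hpa, hk.1, hk.2]
  have hsum : ∀ f : ℕ × ℕ → ℝ, (∑' t : ℕ × ℕ, f t * u t) =
      ∑ a ∈ Finset.range (za + 1), ∑ b ∈ Finset.range 2, f (a, b) * u (a, b) := by
    intro f
    rw [tsum_eq_sum (s := Finset.range (za + 1) ×ˢ Finset.range 2), Finset.sum_product]
    rintro ⟨a, b⟩ hk
    rw [hu']
    by_cases h : a ≤ za
    · have hb : 2 ≤ b := by
        by_contra hb
        exact hk (by simp; omega)
      simp [show b ≠ 0 by omega, show b ≠ 1 by omega]
    · simp [Nat.choose_eq_zero_of_lt (not_le.mp h)]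
  have hz : (za : ℝ) ≠ 0 := by
    have : za ≠ 0 := by omega
    exact_mod_cast this
  have hz1 : (za : ℝ) + 1 ≠ 0 := by positivity
  have hz2 : 1 + (za : ℝ) ≠ 0 := by positivity
  constructor
  · rw [hsum (fun t => (t.1 : ℝ))]
    have : (za : ℝ) * πaa = 1 - p / (1 + (za : ℝ)) := by
      rw [hπaa]; field_simp; ring
    rw [← this, ← binom_mean]
    refine Finset.sum_congr rfl fun a _ => ?_
    simp only [Finset.sum_range_succ, Finset.sum_range_zero, hu']
    simp; ring
  · rw [hsum (fun t => (t.2 : ℝ))]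
    have : p / (1 + (zb : ℝ)) = 1 * (p * πab) := by
      rw [hπab]; ring
    rw [this, ← binom_total za πaa, Finset.sum_mul]
    refine Finset.sum_congr rfl fun a _ => ?_
    simp only [Finset.sum_range_succ, Finset.sum_range_zero, hu']
    simp
end

section
/- Fix integers $z_a, z_b \ge 1$ and $p \in [0,1]$, and let $M$ be the $2\times 2$ real matrix $M = \begin{pmatrix} 1 - \frac{p}{1+z_a} & \frac{p}{1+z_b} \\ \frac{p}{1+z_a} & 1 - \frac{p}{1+z_b} \end{pmatrix}$. Then the characteristic polynomial of $M$ factors as $(\lambda - 1)\big(\lambda - (1 - \frac{p}{1+z_a} - \frac{p}{1+z_b})\big)$; both eigenvalues $1$ and $1 - \frac{p}{1+z_a} - \frac{p}{1+z_b}$ lie in $[0,1]$, so the spectral radius of $M$ equals $1$. -/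
open Polynomial

theorem branching_moment_matrix_critical
    (za zb : ℕ) (hza : 1 ≤ za) (hzb : 1 ≤ zb)
    (p : ℝ) (hp : p ∈ Set.Icc (0 : ℝ) 1)
    (M : Matrix (Fin 2) (Fin 2) ℝ)
    (hM : M = !![1 - p / (1 + (za : ℝ)), p / (1 + (zb : ℝ));
                 p / (1 + (za : ℝ)), 1 - p / (1 + (zb : ℝ))]) :
    M.charpoly =
      (X - C 1) * (X - C (1 - p / (1 + (za : ℝ)) - p / (1 + (zb : ℝ))))
    ∧ (0 : ℝ) ≤ 1 - p / (1 + (za : ℝ)) - p / (1 + (zb : ℝ))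
    ∧ 1 - p / (1 + (za : ℝ)) - p / (1 + (zb : ℝ)) ≤ 1
    ∧ (∀ z : ℂ, (M.charpoly.map (algebraMap ℝ ℂ)).IsRoot z → ‖z‖ ≤ 1)
    ∧ M.charpoly.IsRoot 1 := by
  obtain ⟨hp0, hp1⟩ := hp
  have hA : (1 : ℝ) ≤ za := by exact_mod_cast hza
  have hB : (1 : ℝ) ≤ zb := by exact_mod_cast hzb
  have ha0 : 0 ≤ p / (1 + (za : ℝ)) := by positivity
  have hb0 : 0 ≤ p / (1 + (zb : ℝ)) := by positivity
  have ha1 : p / (1 + (za : ℝ)) ≤ 1 / 2 := by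
    rw [div_le_iff₀ (by positivity)]; linarith
  have hb1 : p / (1 + (zb : ℝ)) ≤ 1 / 2 := by
    rw [div_le_iff₀ (by positivity)]; linarith
  generalize p / (1 + (za : ℝ)) = a at *
  generalize p / (1 + (zb : ℝ)) = b at *
  have hc : M.charpoly = (X - C 1) * (X - C (1 - a - b)) := by
    rw [hM, Matrix.charpoly_fin_two, Matrix.trace_fin_two_of, Matrix.det_fin_two_of]
    simp only [map_sub, map_add, map_mul, map_one]
    ring
  refine ⟨hc, by linarith, by linarith, ?_, by simp [hc]⟩
  intro z hz
  rw [hc, IsRoot.def, Polynomial.map_mul, eval_mul, mul_eq_zero] at hz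
  rcases hz with hz | hz
  · have : z = 1 := by
      simpa [sub_eq_zero] using hz
    simp [this]
  · have : z = ((1 - a - b : ℝ) : ℂ) := by
      rw [Polynomial.map_sub, map_X, map_C, eval_sub, eval_X, eval_C, sub_eq_zero] at hz
      exact hz
    rw [this, Complex.norm_real, Real.norm_eq_abs, abs_le]
    constructor <;> linarith
end

section
/- Let $P : \mathbb{N} \to [0,1]$ be a probability mass function with mean $\mu := \sum_k k\, P(k)$ finite and strictly positive. Define $q(k) = P(k)/\mu$ for $k \ge 1$ and $q(0) = 1 - \sum_{k \ge 1} P(k)/\mu$. Then $q$ is a probability mass function on $\mathbb{N}$ (in particular $\sum_{k\ge1} P(k)/\mu \le 1$, so $q(0) \ge 0$), and its mean is exactly one: $\sum_k k\, q(k) = 1$. -/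
theorem single_network_branching_is_critical
    (P : ℕ → ℝ) (hP0 : ∀ k, 0 ≤ P k) (hP1 : ∑' k : ℕ, P k = 1)
    (μ : ℝ) (hμ : μ = ∑' k : ℕ, (k : ℝ) * P k)
    (hμsummable : Summable (fun k : ℕ => (k : ℝ) * P k))
    (hμpos : 0 < μ)
    (q : ℕ → ℝ)
    (hq : ∀ k : ℕ, 1 ≤ k → q k = P k / μ)
    (hq0 : q 0 = 1 - ∑' k : ℕ, (if k = 0 then 0 else P k / μ)) :
    (∑' k : ℕ, (if k = 0 then 0 else P k / μ)) ≤ 1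
    ∧ (∀ k, 0 ≤ q k)
    ∧ (∑' k : ℕ, q k = 1)
    ∧ (∑' k : ℕ, (k : ℝ) * q k = 1) := by
  have hmean : HasSum (fun k : ℕ => (k : ℝ) * P k / μ) 1 := by
    have h := hμsummable.hasSum.div_const μ
    rwa [← hμ, div_self hμpos.ne'] at h
  have hnn : ∀ k : ℕ, (0 : ℝ) ≤ (if k = 0 then 0 else P k / μ) := by
    intro k
    split_ifs
    · exact le_rfl
    · exact div_nonneg (hP0 k) hμpos.le
  have hle : ∀ k : ℕ, (if k = 0 then 0 else P k / μ) ≤ (k : ℝ) * P k / μ := by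
    intro k
    split_ifs with h
    · simp [h]
    · have hk : (1 : ℝ) ≤ k := by exact_mod_cast Nat.one_le_iff_ne_zero.mpr h
      have h2 : P k ≤ (k : ℝ) * P k := le_mul_of_one_le_left (hP0 k) hk
      exact div_le_div_of_nonneg_right h2 hμpos.le
  have hs : Summable (fun k : ℕ => (if k = 0 then (0 : ℝ) else P k / μ)) :=
    Summable.of_nonneg_of_le hnn hle hmean.summable
  have h1 : (∑' k : ℕ, (if k = 0 then 0 else P k / μ)) ≤ 1 :=
    (hs.tsum_le_tsum hle hmean.summable).trans_eq hmean.tsum_eq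
  refine ⟨h1, ?_, ?_, ?_⟩
  · intro k
    rcases Nat.eq_zero_or_pos k with rfl | hk
    · linarith
    · rw [hq k hk]
      exact div_nonneg (hP0 k) hμpos.le
  · have h := hs.hasSum.add (hasSum_ite_eq (0 : ℕ) (q 0))
    have he : (fun k : ℕ => (if k = 0 then (0 : ℝ) else P k / μ) + (if k = 0 then q 0 else 0)) = q := by
      funext k
      by_cases hk : k = 0
      · simp [hk]
      · simp [hk, hq k (Nat.one_le_iff_ne_zero.mpr hk)]
    rw [he] at h
    rw [h.tsum_eq]
    linarith
  · rw [← hmean.tsum_eq]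
    refine tsum_congr fun k => ?_
    rcases Nat.eq_zero_or_pos k with rfl | hk
    · simp
    · rw [hq k hk, mul_div_assoc]
end

section
/- Fix integers $z_a, z_b \ge 2$ and $p \in (0,1]$, and let $\mathcal{U}_a(\tau_a,\tau_b) = \dfrac{\big(p - p\tau_a + (z_a+1)(\tau_a + z_a - 1)\big)^{z_a}\, \big(1 + p(\tau_b - 1) + z_b\big)}{(z_a+1)^{z_a}\, z_a^{z_a}\, (z_b+1)}$. Then for $\tau_a^* = \dfrac{z_a^2 + p - 1}{(1 - z_a)(p - 1 - z_a)}$ and every $\tau_b \in \mathbb{C}$, one has $\mathcal{U}_a(\tau_a^*, \tau_b) - \tau_a^*\,\dfrac{\partial \mathcal{U}_a}{\partial \tau_a}(\tau_a^*, \tau_b) = 0$. -/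
theorem singularity_family_of_Ua
    (za zb : ℕ) (hza : 2 ≤ za) (hzb : 2 ≤ zb)
    (p : ℝ) (hp : p ∈ Set.Ioc (0 : ℝ) 1)
    (Ua : ℂ → ℂ → ℂ)
    (hUa : ∀ τa τb : ℂ, Ua τa τb =
      ((p : ℂ) - (p : ℂ) * τa + ((za : ℂ) + 1) * (τa + (za : ℂ) - 1)) ^ za *
        (1 + (p : ℂ) * (τb - 1) + (zb : ℂ)) /
        (((za : ℂ) + 1) ^ za * (za : ℂ) ^ za * ((zb : ℂ) + 1)))
    (τa' : ℂ)
    (hτa : τa' = ((za : ℂ) ^ 2 + (p : ℂ) - 1) /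
      ((1 - (za : ℂ)) * ((p : ℂ) - 1 - (za : ℂ)))) :
    ∀ τb : ℂ, Ua τa' τb - τa' * deriv (fun t => Ua t τb) τa' = 0 := by
  intro τb
  have h1 : (1 - (za : ℂ)) ≠ 0 := by
    intro h
    have h' : (za : ℂ) = 1 := by linear_combination -h
    have h2 : za = 1 := by exact_mod_cast h'
    omega
  have h2 : ((p : ℂ) - 1 - (za : ℂ)) ≠ 0 := by
    intro h
    have h' : ((p - 1 - (za : ℝ) : ℝ) : ℂ) = 0 := by push_cast; exact h
    have h3 : p - 1 - (za : ℝ) = 0 := by exact_mod_cast h'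
    have h4 : (2 : ℝ) ≤ za := by exact_mod_cast hza
    have := hp.2
    linarith
  have key : τa' * ((1 - (za : ℂ)) * ((p : ℂ) - 1 - (za : ℂ))) = (za : ℂ) ^ 2 + (p : ℂ) - 1 := by
    rw [hτa]
    exact div_mul_cancel₀ _ (mul_ne_zero h1 h2)
  have hlin : (p : ℂ) - (p : ℂ) * τa' + ((za : ℂ) + 1) * (τa' + (za : ℂ) - 1)
      = τa' * (za * ((za : ℂ) + 1 - p)) := by
    linear_combination -key
  have hd0 : HasDerivAt
      (fun t : ℂ => (p : ℂ) - (p : ℂ) * t + ((za : ℂ) + 1) * (t + (za : ℂ) - 1))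
      ((za : ℂ) + 1 - p) τa' := by
    have := (((hasDerivAt_id τa').const_mul (p : ℂ)).const_sub (p : ℂ)).add
      ((((hasDerivAt_id τa').add_const (za : ℂ)).sub_const 1).const_mul ((za : ℂ) + 1))
    refine HasDerivAt.congr_deriv (f' := -((p : ℂ) * 1) + ((za : ℂ) + 1) * 1) this ?_
    ring
  have hd := ((hd0.pow za).mul_const (1 + (p : ℂ) * (τb - 1) + (zb : ℂ))).div_const
    (((za : ℂ) + 1) ^ za * (za : ℂ) ^ za * ((zb : ℂ) + 1))
  have hfun : (fun t => Ua t τb) = fun t : ℂ =>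
      ((p : ℂ) - (p : ℂ) * t + ((za : ℂ) + 1) * (t + (za : ℂ) - 1)) ^ za *
        (1 + (p : ℂ) * (τb - 1) + (zb : ℂ)) /
        (((za : ℂ) + 1) ^ za * (za : ℂ) ^ za * ((zb : ℂ) + 1)) := by
    funext t
    exact hUa t τb
  have hder := hd.deriv
  simp only [Pi.pow_apply] at hder
  rw [hfun, hder, hUa]
  have hpow : ∀ L : ℂ, L ^ za = L ^ (za - 1) * L := fun L => by
    rw [← pow_succ]; congr 1; omega
  rw [hpow ((p : ℂ) - (p : ℂ) * τa' + ((za : ℂ) + 1) * (τa' + (za : ℂ) - 1))]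
  generalize ((p : ℂ) - (p : ℂ) * τa' + ((za : ℂ) + 1) * (τa' + (za : ℂ) - 1)) ^ (za - 1) = M
  rw [hlin]
  ring
end
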